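/- Let (Ω, 𝓕, ℙ) be a probability space, let u : ℝ → ℝ be concave and differentiable with u'(y) > 0 for all y, and let P be an essentially bounded real-valued random variable. Let ũ(z) := sup_{x ∈ ℝ} (u(x) − x·z) for z > 0. Suppose r* ∈ ℝ satisfies E[u'(P − r*)] = 1, and set D* := u'(P − r*). Then D* > 0, E[D*] = 1, ũ(D*) = u(P − r*) − (P − r*)·u'(P − r*) pointwise, and E[D*·P] + E[ũ(D*)] = E[u(P − r*)] + r* = S(P); consequently S(P) equals the minimum of E[D·P] + E[ũ(D)] over all random variables D with D > 0 a.s., E[D] = 1, D·P integrable and ũ(D) integrable, and this minimum is attained at D*. -/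

import Mathlib

open MeasureTheory

/-- The convex conjugate `ũ(z) = sup_{x ∈ ℝ} (u(x) − x·z)`. -/
noncomputable def convexConjugate (u : ℝ → ℝ) (z : ℝ) : ℝ :=
  sSup (Set.range fun x : ℝ => u x - x * z)

/-- A differentiable concave function on the line lies below its tangents. -/
theorem ConcaveOn.le_tangent {u : ℝ → ℝ} (hconc : ConcaveOn ℝ Set.univ u)
    (hdiff : Differentiable ℝ u) (x y : ℝ) : u x ≤ u y + deriv u y * (x - y) := by
  rcases lt_trichotomy x y with h | h | h
  · have := hconc.deriv_le_slope (Set.mem_univ x) (Set.mem_univ y) h (hdiff y)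
    rw [slope_def_field, le_div_iff₀ (sub_pos.2 h)] at this
    linarith
  · simp [h]
  · have := hconc.slope_le_deriv (Set.mem_univ y) (Set.mem_univ x) h (hdiff y)
    rw [slope_def_field, div_le_iff₀ (sub_pos.2 h)] at this
    linarith

theorem convexConjugate_deriv {u : ℝ → ℝ} (hconc : ConcaveOn ℝ Set.univ u)
    (hdiff : Differentiable ℝ u) (y : ℝ) :
    convexConjugate u (deriv u y) = u y - y * deriv u y := by
  refine IsGreatest.csSup_eq ⟨⟨y, rfl⟩, ?_⟩
  rintro _ ⟨x, rfl⟩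
  have := hconc.le_tangent hdiff x y
  dsimp only
  linarith

/-- A continuous function of an essentially bounded random variable is integrable. -/
theorem Continuous.integrable_comp_of_ae_abs_le {Ω : Type*} [MeasurableSpace Ω] {μ : Measure Ω}
    [IsFiniteMeasure μ] {f : ℝ → ℝ} (hf : Continuous f) {X : Ω → ℝ} (hX : AEMeasurable X μ)
    {C : ℝ} (hC : ∀ᵐ ω ∂μ, |X ω| ≤ C) : Integrable (fun ω => f (X ω)) μ := by
  obtain ⟨B, hB⟩ := (isCompact_Icc (a := -C) (b := C)).exists_bound_of_continuousOn hf.continuousOn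
  refine Integrable.of_bound (hf.measurable.comp_aemeasurable hX).aestronglyMeasurable B ?_
  filter_upwards [hC] with ω hω using hB _ (abs_le.1 hω)

/-- **strong duality for the OCE.** Let `u` be concave and differentiable with
`u' > 0`, `P` essentially bounded, and suppose `r*` satisfies `E[u'(P − r*)] = 1`. Set
`D* := u'(P − r*)`. Then `D* > 0`, `E[D*] = 1`,
`ũ(D*) = u(P − r*) − (P − r*)·u'(P − r*)` pointwise, `D*·P` and `ũ(D*)` are integrable, and
`E[D*·P] + E[ũ(D*)] = E[u(P − r*)] + r* = S(P)`; consequently `S(P)` equals the minimum of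
`E[D·P] + E[ũ(D)]` over all `D` with `D > 0` a.s., `E[D] = 1`, `D·P` integrable and `ũ(D)`
integrable (with `ũ(D) < ∞` a.s.), the minimum being attained at `D*`. -/
theorem oce_strong_duality {Ω : Type*} [MeasurableSpace Ω]
    (μ : Measure Ω) [IsProbabilityMeasure μ]
    (u : ℝ → ℝ) (hconc : ConcaveOn ℝ Set.univ u) (hdiff : Differentiable ℝ u)
    (hderiv_pos : ∀ y : ℝ, 0 < deriv u y)
    (P : Ω → ℝ) (hP : Measurable P)
    (hPbdd : ∃ C : ℝ, ∀ᵐ ω ∂μ, |P ω| ≤ C)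
    (rstar : ℝ) (hfoc : (∫ ω, deriv u (P ω - rstar) ∂μ) = 1) :
    (∀ ω : Ω, 0 < deriv u (P ω - rstar)) ∧
    (∫ ω, deriv u (P ω - rstar) ∂μ) = 1 ∧
    (∀ ω : Ω, convexConjugate u (deriv u (P ω - rstar))
        = u (P ω - rstar) - (P ω - rstar) * deriv u (P ω - rstar)) ∧
    Integrable (fun ω => deriv u (P ω - rstar) * P ω) μ ∧
    Integrable (fun ω => convexConjugate u (deriv u (P ω - rstar))) μ ∧
    ((∫ ω, deriv u (P ω - rstar) * P ω ∂μ)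
        + (∫ ω, convexConjugate u (deriv u (P ω - rstar)) ∂μ)
      = (∫ ω, u (P ω - rstar) ∂μ) + rstar) ∧
    ((∫ ω, u (P ω - rstar) ∂μ) + rstar
      = sSup (Set.range fun r : ℝ => (∫ ω, u (P ω - r) ∂μ) + r)) ∧
    (∀ D : Ω → ℝ, Measurable D → (∀ᵐ ω ∂μ, 0 < D ω) → (∫ ω, D ω ∂μ) = 1 →
      Integrable (fun ω => D ω * P ω) μ →
      (∀ᵐ ω ∂μ, BddAbove (Set.range fun x : ℝ => u x - x * D ω)) →
      Integrable (fun ω => convexConjugate u (D ω)) μ →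
      sSup (Set.range fun r : ℝ => (∫ ω, u (P ω - r) ∂μ) + r)
        ≤ (∫ ω, D ω * P ω ∂μ) + ∫ ω, convexConjugate u (D ω) ∂μ) := by
  obtain ⟨C, hC⟩ := hPbdd
  have hu : ∀ r, Integrable (fun ω => u (P ω - r)) μ := fun r =>
    (hdiff.continuous.comp (continuous_id.sub continuous_const)).integrable_comp_of_ae_abs_le
      hP.aemeasurable hC
  have hD : Integrable (fun ω => deriv u (P ω - rstar)) μ :=
    .of_integral_ne_zero (by rw [hfoc]; exact one_ne_zero)
  have hDP : Integrable (fun ω => deriv u (P ω - rstar) * P ω) μ :=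
    hD.mul_bdd hP.aestronglyMeasurable hC
  have hconj : ∀ ω, convexConjugate u (deriv u (P ω - rstar))
      = u (P ω - rstar) - (deriv u (P ω - rstar) * P ω - rstar * deriv u (P ω - rstar)) :=
    fun ω => by rw [convexConjugate_deriv hconc hdiff]; ring
  have hshift : Integrable
      (fun ω => deriv u (P ω - rstar) * P ω - rstar * deriv u (P ω - rstar)) μ :=
    hDP.sub (hD.const_mul rstar)
  have hprimal : ∀ r, (∫ ω, u (P ω - r) ∂μ) + r ≤ (∫ ω, u (P ω - rstar) ∂μ) + rstar := by
    intro r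
    have hle : ∫ ω, u (P ω - r) ∂μ
        ≤ ∫ ω, (u (P ω - rstar) + deriv u (P ω - rstar) * (rstar - r)) ∂μ := by
      refine integral_mono (hu r) ((hu rstar).add (hD.mul_const _)) fun ω => ?_
      have := hconc.le_tangent hdiff (P ω - r) (P ω - rstar)
      rwa [sub_sub_sub_cancel_left] at this
    rw [integral_add (hu rstar) (hD.mul_const _), integral_mul_const, hfoc] at hle
    linarith
  refine ⟨fun ω => hderiv_pos _, hfoc, fun ω => convexConjugate_deriv hconc hdiff _, hDP,
    ?_, ?_, ?_, ?_⟩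
  · simp_rw [hconj]
    exact (hu rstar).sub hshift
  · simp_rw [hconj]
    rw [integral_sub (hu rstar) hshift, integral_sub hDP (hD.const_mul rstar),
      integral_const_mul, hfoc]
    ring
  · refine Eq.symm (IsGreatest.csSup_eq ⟨⟨rstar, rfl⟩, ?_⟩)
    rintro _ ⟨r, rfl⟩
    exact hprimal r
  · intro D _ _ hD1 hDP' hbdd hint
    have hD' : Integrable D μ := .of_integral_ne_zero (by rw [hD1]; exact one_ne_zero)
    refine csSup_le (Set.range_nonempty _) ?_
    rintro _ ⟨r, rfl⟩
    have hshift' : Integrable (fun ω => D ω * P ω - r * D ω) μ := hDP'.sub (hD'.const_mul r)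
    have hle : ∫ ω, u (P ω - r) ∂μ
        ≤ ∫ ω, (D ω * P ω - r * D ω + convexConjugate u (D ω)) ∂μ := by
      refine integral_mono_ae (hu r) (hshift'.add hint) ?_
      filter_upwards [hbdd] with ω hω
      have : u (P ω - r) - (P ω - r) * D ω ≤ convexConjugate u (D ω) :=
        le_csSup hω ⟨P ω - r, rfl⟩
      linarith
    rw [integral_add hshift' hint, integral_sub hDP' (hD'.const_mul r), integral_const_mul, hD1] at hle
    dsimp only
    linarith
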